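/- Let S be a finite set of sites with finite-dimensional Hilbert spaces H_x, partitioned as S = A ⊔ B, and let H = ⊗_{x∈S} H_x. For I ⊆ S let 𝒜_I denote the subalgebra of operators on H of the form P ⊗ 𝟙_{S∖I} with P an operator on ⊗_{x∈I} H_x, and for an operator T on H define ‖T‖_I := inf{‖T − P‖ : P ∈ 𝒜_I}. Then for every operator T on H, every state ρ_A on ⊗_{x∈A} H_x, every I ⊆ S, and I' := I ∩ B, one has ‖tr_A[(ρ_A ⊗ 𝟙_B) T]‖_{I'} ≤ ‖T‖_I, where tr_A denotes the partial trace over the sites in A and the left-hand side interval norm is computed for operators on ⊗_{x∈B} H_x. -/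

import Mathlib

open scoped Matrix ComplexOrder
noncomputable section

namespace Paper

variable {n : Type*} [Fintype n] [DecidableEq n]

/-- The operator norm of a matrix, acting on the Euclidean space. -/
def opNorm (A : Matrix n n ℂ) : ℝ :=
  ‖(Matrix.toEuclideanLin A).toContinuousLinearMap‖

section Sites

variable {S : Type*} [Fintype S] [DecidableEq S]
  (Hx : S → Type*) [∀ x, Fintype (Hx x)] [∀ x, DecidableEq (Hx x)]

open scoped Classical in
/-- Embedding of an operator acting on the sites in `I` into an operator on all sites,
`P ↦ P ⊗ 𝟙`. -/
def embedSites (I : Finset S) (P : Matrix (∀ x : I, Hx x.1) (∀ x : I, Hx x.1) ℂ) :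
    Matrix (∀ x, Hx x) (∀ x, Hx x) ℂ :=
  Matrix.of fun f g =>
    P (fun x => f x.1) (fun x => g x.1) * (if ∀ x, x ∉ I → f x = g x then 1 else 0)

/-- The locality measure `‖T‖_I = inf { ‖T - P‖ : P ∈ 𝒜_I }`, where `𝒜_I` is the set of
operators acting nontrivially only on the sites in `I`. -/
def intervalNorm (I : Finset S) (T : Matrix (∀ x, Hx x) (∀ x, Hx x) ℂ) : ℝ :=
  sInf (Set.range fun P : Matrix (∀ x : I, Hx x.1) (∀ x : I, Hx x.1) ℂ =>
    opNorm (T - embedSites Hx I P))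

open scoped Classical in
/-- Merging a configuration on `A` with one on `Aᶜ`. -/
def glueSites (A : Finset S) (f : ∀ x : A, Hx x.1) (g : ∀ x : (Aᶜ : Finset S), Hx x.1) :
    ∀ x, Hx x :=
  fun x => if hx : x ∈ A then f ⟨x, hx⟩ else g ⟨x, Finset.mem_compl.mpr hx⟩

/-- The partial trace over the sites in `A`, producing an operator on the remaining
sites `B = Aᶜ`. -/
def ptrSites (A : Finset S) (M : Matrix (∀ x, Hx x) (∀ x, Hx x) ℂ) :
    Matrix (∀ x : (Aᶜ : Finset S), Hx x.1) (∀ x : (Aᶜ : Finset S), Hx x.1) ℂ :=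
  Matrix.of fun a b => ∑ f : ∀ x : A, Hx x.1, M (glueSites Hx A f a) (glueSites Hx A f b)

theorem opNorm_nonneg {n : Type*} [Fintype n] [DecidableEq n] (M : Matrix n n ℂ) :
    0 ≤ opNorm M :=
  norm_nonneg _

theorem sum_eq_inner_toEuclideanLin {n : Type*} [Fintype n] [DecidableEq n]
    (M : Matrix n n ℂ) (x y : EuclideanSpace ℂ n) :
    ∑ i, ∑ j, star (x i) * M i j * y j =
      inner ℂ x ((Matrix.toEuclideanLin M).toContinuousLinearMap y) := by
  simp [PiLp.inner_apply, Matrix.mulVec, dotProduct, Finset.sum_mul, mul_right_comm,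
    mul_comm (starRingEnd ℂ _)]

theorem norm_sum_le_opNorm {n : Type*} [Fintype n] [DecidableEq n] (M : Matrix n n ℂ)
    (x y : EuclideanSpace ℂ n) :
    ‖∑ i, ∑ j, star (x i) * M i j * y j‖ ≤ opNorm M * ‖x‖ * ‖y‖ := by
  rw [sum_eq_inner_toEuclideanLin]
  refine (norm_inner_le_norm _ _).trans ?_
  have := (Matrix.toEuclideanLin M).toContinuousLinearMap.le_opNorm y
  calc _ ≤ ‖x‖ * (opNorm M * ‖y‖) := by gcongr; exact this
    _ = _ := by ring

theorem opNorm_le_of_norm_sum_le {n : Type*} [Fintype n] [DecidableEq n] (M : Matrix n n ℂ)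
    {C : ℝ} (hC : 0 ≤ C)
    (h : ∀ x y : EuclideanSpace ℂ n,
      ‖∑ i, ∑ j, star (x i) * M i j * y j‖ ≤ C * ‖x‖ * ‖y‖) :
    opNorm M ≤ C := by
  refine ContinuousLinearMap.opNorm_le_bound _ hC fun y => ?_
  set z := (Matrix.toEuclideanLin M).toContinuousLinearMap y with hz
  have h2 := h z y
  rw [sum_eq_inner_toEuclideanLin, ← hz, inner_self_eq_norm_sq_to_K] at h2
  simp only [norm_pow, RCLike.norm_ofReal, abs_norm] at h2
  rcases (norm_nonneg z).eq_or_lt with h0 | h0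
  · rw [← h0]; positivity
  · nlinarith

/-- The map `M ↦ tr_α[(ρ ⊗ 𝟙) M]` is a contraction for every state `ρ`. -/
theorem opNorm_weightedTrace_le {α β γ : Type*} [Fintype α] [DecidableEq α] [Fintype β]
    [DecidableEq β] [Fintype γ] [DecidableEq γ] (e : α × β ≃ γ) {ρ : Matrix α α ℂ}
    (hρ : ρ.PosSemidef) (htr : ρ.trace = 1) (M : Matrix γ γ ℂ) :
    opNorm (Matrix.of fun a b => ∑ f, ∑ f', ρ f f' * M (e (f', a)) (e (f, b))) ≤ opNorm M := by
  obtain ⟨K, hK⟩ : ∃ K : Matrix α α ℂ, ρ = Kᴴ * K := by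
    open scoped MatrixOrder in
    simpa [Matrix.star_eq_conjTranspose] using
      CStarAlgebra.nonneg_iff_eq_star_mul_self.mp hρ.nonneg
  have htr' : ∑ k, ∑ f, ‖K k f‖ ^ 2 = 1 := by
    have : ((∑ k, ∑ f, ‖K k f‖ ^ 2 : ℝ) : ℂ) = 1 := by
      rw [← htr, hK, Finset.sum_comm]
      simp [Matrix.trace, Matrix.mul_apply, ← Complex.conj_mul']
    exact_mod_cast this
  refine opNorm_le_of_norm_sum_le _ (opNorm_nonneg M) fun x y => ?_
  let X : α → EuclideanSpace ℂ β → EuclideanSpace ℂ γ := fun k x =>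
    WithLp.toLp 2 fun c => star (K k (e.symm c).1) * x (e.symm c).2
  have hX : ∀ k x, ‖X k x‖ ^ 2 = (∑ f, ‖K k f‖ ^ 2) * ‖x‖ ^ 2 := fun k x => by
    rw [EuclideanSpace.norm_sq_eq, EuclideanSpace.norm_sq_eq, ← e.sum_comp,
      Fintype.sum_prod_type, Finset.sum_mul_sum]
    simp [X, mul_pow]
  have key : ∑ a, ∑ b, star (x a) *
        (Matrix.of fun a b => ∑ f, ∑ f', ρ f f' * M (e (f', a)) (e (f, b))) a b * y b =
      ∑ k, ∑ c, ∑ d, star (X k x c) * M c d * X k y d := by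
    have hr : ∀ k, ∑ c, ∑ d, star (X k x c) * M c d * X k y d =
        ∑ a, ∑ b, ∑ f, ∑ f',
          star (x a) * (star (K k f) * K k f' * M (e (f', a)) (e (f, b))) * y b := fun k => by
      rw [← e.sum_comp, Fintype.sum_prod_type, Finset.sum_comm]
      refine Finset.sum_congr rfl fun a _ => ?_
      have hd : ∀ c, ∑ d, star (X k x c) * M c d * X k y d =
          ∑ f, ∑ b, star (X k x c) * M c (e (f, b)) * X k y (e (f, b)) := fun c => by
        rw [← e.sum_comp, Fintype.sum_prod_type]
      simp_rw [hd]
      rw [Finset.sum_comm]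
      conv_rhs => rw [Finset.sum_comm]
      refine Finset.sum_congr rfl fun f _ => ?_
      rw [Finset.sum_comm]
      refine Finset.sum_congr rfl fun b _ => ?_
      refine Finset.sum_congr rfl fun f' _ => ?_
      simp [X]
      ring
    simp_rw [hr]
    conv_rhs => rw [Finset.sum_comm]
    refine Finset.sum_congr rfl fun a _ => ?_
    conv_rhs => rw [Finset.sum_comm]
    refine Finset.sum_congr rfl fun b _ => ?_
    conv_rhs => rw [Finset.sum_comm]
    rw [Matrix.of_apply, Finset.mul_sum, Finset.sum_mul]
    refine Finset.sum_congr rfl fun f _ => ?_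
    conv_rhs => rw [Finset.sum_comm]
    rw [Finset.mul_sum, Finset.sum_mul]
    refine Finset.sum_congr rfl fun f' _ => ?_
    rw [hK, Matrix.mul_apply, Finset.sum_mul, Finset.mul_sum, Finset.sum_mul]
    simp
  rw [key]
  calc _ ≤ ∑ k, opNorm M * ‖X k x‖ * ‖X k y‖ :=
        (norm_sum_le _ _).trans (Finset.sum_le_sum fun k _ => norm_sum_le_opNorm M _ _)
    _ = ∑ k, opNorm M * ((∑ f, ‖K k f‖ ^ 2) * (‖x‖ * ‖y‖)) := by
        refine Finset.sum_congr rfl fun k _ => ?_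
        rw [mul_assoc]
        congr 1
        have h0 : 0 ≤ ∑ f, ‖K k f‖ ^ 2 := by positivity
        refine (sq_eq_sq₀ (by positivity) (by positivity)).mp ?_
        rw [mul_pow, hX, hX]
        ring
    _ = opNorm M * ‖x‖ * ‖y‖ := by
        rw [← Finset.mul_sum, ← Finset.sum_mul, htr']
        ring

/-- `glueSites` as an equivalence. -/
def glueEquiv (A : Finset S) :
    (∀ x : A, Hx x.1) × (∀ x : (Aᶜ : Finset S), Hx x.1) ≃ ∀ x, Hx x where
  toFun p := glueSites Hx A p.1 p.2
  invFun h := (fun x => h x.1, fun x => h x.1)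
  left_inv p := by
    ext x
    · simp [glueSites]
    · have := Finset.mem_compl.mp x.2
      simp [glueSites, this]
  right_inv h := by
    ext x
    simp [glueSites]

theorem ptrSites_embedSites_mul (A : Finset S)
    (ρ : Matrix (∀ x : A, Hx x.1) (∀ x : A, Hx x.1) ℂ)
    (M : Matrix (∀ x, Hx x) (∀ x, Hx x) ℂ) :
    ptrSites Hx A (embedSites Hx A ρ * M) =
      Matrix.of fun a b => ∑ f, ∑ f', ρ f f' *
        M (glueEquiv Hx A (f', a)) (glueEquiv Hx A (f, b)) := by
  classical
  ext a b
  rw [ptrSites, Matrix.of_apply, Matrix.of_apply]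
  refine Finset.sum_congr rfl fun f _ => ?_
  rw [Matrix.mul_apply, ← (glueEquiv Hx A).sum_comp, Fintype.sum_prod_type]
  refine Finset.sum_congr rfl fun f' _ => ?_
  have hcond : ∀ a', (∀ x, x ∉ A → glueSites Hx A f a x = glueSites Hx A f' a' x) ↔
      a = a' := fun a' => by
    refine ⟨fun h => ?_, fun h x hx => by simp [glueSites, hx, h]⟩
    ext x
    have hx := Finset.mem_compl.mp x.2
    simpa [glueSites, hx] using h x.1 hx
  have hA : ∀ g a', (fun x : A => glueSites Hx A g a' x.1) = g := fun g a' => by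
    ext x
    simp [glueSites]
  simp [embedSites, glueEquiv, hcond, hA]

/-- Merging a configuration on `A` with one on `I ∩ Aᶜ` into a configuration on `I`. -/
def glueOn (A I : Finset S) (f : ∀ x : A, Hx x.1)
    (u : ∀ x : I.subtype (· ∈ (Aᶜ : Finset S)), Hx x.1.1) : ∀ x : I, Hx x.1 :=
  fun x => if hx : x.1 ∈ A then f ⟨x.1, hx⟩
    else u ⟨⟨x.1, Finset.mem_compl.mpr hx⟩, Finset.mem_subtype.mpr x.2⟩

open scoped Classical in
/-- The operator on `I ∩ Aᶜ` obtained by tracing out `A` from an operator on `I`. -/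
def reducedOperator (A I : Finset S) (ρ : Matrix (∀ x : A, Hx x.1) (∀ x : A, Hx x.1) ℂ)
    (P : Matrix (∀ x : I, Hx x.1) (∀ x : I, Hx x.1) ℂ) :
    Matrix (∀ x : I.subtype (· ∈ (Aᶜ : Finset S)), Hx x.1.1)
      (∀ x : I.subtype (· ∈ (Aᶜ : Finset S)), Hx x.1.1) ℂ :=
  Matrix.of fun u v => ∑ f, ∑ f', ρ f f' * (P (glueOn Hx A I f' u) (glueOn Hx A I f v) *
    (if ∀ x : A, x.1 ∉ I → f' x = f x then 1 else 0))

theorem ptrSites_embedSites_mul_embedSites (A I : Finset S)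
    (ρ : Matrix (∀ x : A, Hx x.1) (∀ x : A, Hx x.1) ℂ)
    (P : Matrix (∀ x : I, Hx x.1) (∀ x : I, Hx x.1) ℂ) :
    ptrSites Hx A (embedSites Hx A ρ * embedSites Hx I P) =
      embedSites (fun x : (Aᶜ : Finset S) => Hx x.1) (I.subtype (· ∈ (Aᶜ : Finset S)))
        (reducedOperator Hx A I ρ P) := by
  classical
  rw [ptrSites_embedSites_mul]
  ext a b
  simp only [embedSites, reducedOperator, Matrix.of_apply, Finset.sum_mul]
  refine Finset.sum_congr rfl fun f _ => Finset.sum_congr rfl fun f' _ => ?_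
  have hglue : ∀ g c, (fun x : I => glueEquiv Hx A (g, c) x.1) =
      glueOn Hx A I g (fun x => c x.1) := fun g c => rfl
  have hcond : (∀ x, x ∉ I → glueEquiv Hx A (f', a) x = glueEquiv Hx A (f, b) x) ↔
      (∀ x : A, x.1 ∉ I → f' x = f x) ∧
        ∀ x : (Aᶜ : Finset S), x ∉ I.subtype (· ∈ (Aᶜ : Finset S)) → a x = b x := by
    refine ⟨fun h => ⟨fun x hx => ?_, fun x hx => ?_⟩, fun h x hx => ?_⟩
    · simpa [glueEquiv, glueSites] using h x.1 hx
    · have hxA := Finset.mem_compl.mp x.2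
      simpa [glueEquiv, glueSites, hxA] using h x.1 (by simpa using hx)
    · by_cases hxA : x ∈ A
      · simpa [glueEquiv, glueSites, hxA] using h.1 ⟨x, hxA⟩ hx
      · simpa [glueEquiv, glueSites, hxA] using
          h.2 ⟨x, Finset.mem_compl.mpr hxA⟩ (by simpa using hx)
  simp only [hglue, hcond, ite_and]
  split_ifs <;> simp

theorem statement7 (S : Type*) [Fintype S] [DecidableEq S]
    (Hx : S → Type*) [∀ x, Fintype (Hx x)] [∀ x, DecidableEq (Hx x)]
    -- the partition `S = A ⊔ B`, with `B := Aᶜ`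
    (A : Finset S)
    (T : Matrix (∀ x, Hx x) (∀ x, Hx x) ℂ)
    (ρA : Matrix (∀ x : A, Hx x.1) (∀ x : A, Hx x.1) ℂ)
    (hρA : ρA.PosSemidef) (htrρA : ρA.trace = 1)
    (I : Finset S) :
    intervalNorm (fun x : (Aᶜ : Finset S) => Hx x.1) (I.subtype (· ∈ (Aᶜ : Finset S)))
        (ptrSites Hx A (embedSites Hx A ρA * T))
      ≤ intervalNorm Hx I T := by
  refine le_csInf (Set.range_nonempty _) ?_
  rintro _ ⟨P, rfl⟩
  refine (csInf_le ⟨0, ?_⟩ (Set.mem_range_self (reducedOperator Hx A I ρA P))).trans ?_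
  · rintro _ ⟨Q, rfl⟩
    exact opNorm_nonneg _
  · have h := opNorm_weightedTrace_le (glueEquiv Hx A) hρA htrρA (T - embedSites Hx I P)
    rw [← ptrSites_embedSites_mul] at h
    refine Eq.trans_le (congrArg opNorm ?_) h
    rw [← ptrSites_embedSites_mul_embedSites]
    ext a b
    simp [ptrSites, Matrix.mul_sub]

end Sites

end Paper
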